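/- arXiv:1508.03136 — 2 statements merged into one kernel-verified Lean document; each statement's English description precedes it below -/
import Mathlib

section
/- For every nondecreasing departure vector d ∈ ℝ^N (d_1 ≤ d_2 ≤ … ≤ d_N) there exists exactly one arrival vector a ∈ ℝ^N such that the pair (a, d) satisfies the dynamics. -/
open MeasureTheory Finset

/-- `(a, d)` satisfies the linear-slowdown processor-sharing dynamics. -/
def SlowdownDynamics (N : ℕ) (α β : ℝ) (a d : Fin N → ℝ) : Prop :=
  (∀ i, a i < d i) ∧
  ∀ i : Fin N,
    (∫ t in (a i)..(d i),
      (β - α * ((∑ j : Fin N, if t ∈ Set.Icc (a j) (d j) then (1 : ℝ) else 0) - 1))) = 1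

/-- The length of the part of `[x, y]` covered by `[u, v]`, as an integral of an indicator. -/
theorem intervalIntegral_indicator_Icc {x y u v : ℝ} (hxy : x ≤ y) :
    (∫ t in x..y, if t ∈ Set.Icc u v then (1 : ℝ) else 0) = max 0 (min y v - max x u) := by
  have hind : (fun t : ℝ => if t ∈ Set.Icc u v then (1 : ℝ) else 0)
      = (Set.Icc u v).indicator 1 := by
    ext t; simp [Set.indicator_apply]
  rw [hind, intervalIntegral.integral_of_le hxy, ← integral_Icc_eq_integral_Ioc,
    integral_indicator_one measurableSet_Icc, measureReal_restrict_apply measurableSet_Icc,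
    Set.Icc_inter_Icc, Real.volume_real_Icc, max_comm 0, min_comm, max_comm x]

theorem intervalIntegrable_indicator_Icc (x y u v : ℝ) :
    IntervalIntegrable (fun t => if t ∈ Set.Icc u v then (1 : ℝ) else 0) volume x y := by
  have hind : (fun t : ℝ => if t ∈ Set.Icc u v then (1 : ℝ) else 0)
      = (Set.Icc u v).indicator 1 := by
    ext t; simp [Set.indicator_apply]
  rw [hind, intervalIntegrable_iff]
  exact (integrableOn_const (C := (1 : ℝ)) (by simp)).indicator measurableSet_Icc

/-- The service rate at time `t`. -/
noncomputable def serviceRate {N : ℕ} (α β : ℝ) (a d : Fin N → ℝ) (t : ℝ) : ℝ :=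
  β - α * ((∑ j : Fin N, if t ∈ Set.Icc (a j) (d j) then (1 : ℝ) else 0) - 1)

theorem intervalIntegrable_sum_indicator_Icc {N : ℕ} (a d : Fin N → ℝ) (x y : ℝ) :
    IntervalIntegrable (fun t => ∑ j : Fin N, if t ∈ Set.Icc (a j) (d j) then (1 : ℝ) else 0)
      volume x y := by
  have := IntervalIntegrable.sum Finset.univ fun j (_ : j ∈ Finset.univ) =>
    intervalIntegrable_indicator_Icc x y (a j) (d j)
  simpa only [Finset.sum_fn] using this

theorem intervalIntegrable_serviceRate {N : ℕ} (α β : ℝ) (a d : Fin N → ℝ) (x y : ℝ) :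
    IntervalIntegrable (serviceRate α β a d) volume x y :=
  intervalIntegrable_const.sub
    (((intervalIntegrable_sum_indicator_Icc a d x y).sub intervalIntegrable_const).const_mul α)

theorem integral_serviceRate {N : ℕ} (α β : ℝ) (a d : Fin N → ℝ) {x y : ℝ} (hxy : x ≤ y) :
    ∫ t in x..y, serviceRate α β a d t
      = β * (y - x) - α * ((∑ j, max 0 (min y (d j) - max x (a j))) - (y - x)) := by
  have hsum := intervalIntegrable_sum_indicator_Icc a d x y
  unfold serviceRate
  rw [intervalIntegral.integral_sub intervalIntegrable_const
      ((hsum.sub intervalIntegrable_const).const_mul α),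
    intervalIntegral.integral_const_mul,
    intervalIntegral.integral_sub hsum intervalIntegrable_const,
    intervalIntegral.integral_finsetSum fun j _ =>
      intervalIntegrable_indicator_Icc x y (a j) (d j)]
  simp only [intervalIntegral_indicator_Icc hxy, intervalIntegral.integral_const, smul_eq_mul]
  ring

theorem le_serviceRate {N : ℕ} {α β : ℝ} (hα : 0 < α) (a d : Fin N → ℝ) (t : ℝ) :
    β - α * ((N : ℝ) - 1) ≤ serviceRate α β a d t := by
  have hcount : (∑ j : Fin N, if t ∈ Set.Icc (a j) (d j) then (1 : ℝ) else 0) ≤ N := by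
    calc _ ≤ ∑ _j : Fin N, (1 : ℝ) := Finset.sum_le_sum fun j _ => by split_ifs <;> norm_num
      _ = N := by simp
  unfold serviceRate
  gcongr

/-- Users who depart in order have arrived in order. -/
theorem SlowdownDynamics.monotone {N : ℕ} {α β : ℝ} {a d : Fin N → ℝ} (hα : 0 < α)
    (hstab : 0 < β - α * ((N : ℝ) - 1)) (hd : Monotone d) (h : SlowdownDynamics N α β a d) :
    Monotone a := by
  intro i j hij
  by_contra! hlt
  have hi : ∫ t in a i..d i, serviceRate α β a d t = 1 := h.2 i
  have hj : ∫ t in a j..d j, serviceRate α β a d t = 1 := h.2 j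
  have hint := intervalIntegrable_serviceRate α β a d
  rw [← intervalIntegral.integral_add_adjacent_intervals (hint (a j) (a i)) (hint _ _),
    ← intervalIntegral.integral_add_adjacent_intervals (hint (a i) (d i)) (hint _ _), hi] at hj
  have hnonneg : 0 ≤ ∫ t in d i..d j, serviceRate α β a d t :=
    intervalIntegral.integral_nonneg (hd hij) fun t _ => hstab.le.trans (le_serviceRate hα a d t)
  have hpos : 0 < ∫ t in a j..a i, serviceRate α β a d t :=
    intervalIntegral.intervalIntegral_pos_of_pos (hint _ _)
      (fun t => hstab.trans_le (le_serviceRate hα a d t)) hlt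
  linarith

/-- The work user `i` receives when arriving at time `x`, disregarding the slowdown caused by
users departing later. -/
def workAfter {N : ℕ} (α β : ℝ) (d : Fin N → ℝ) (i : Fin N) (x : ℝ) : ℝ :=
  β * (d i - x) - α * ∑ j ∈ Iio i, max 0 (d j - x)

/-- The work user `i` must receive to be done, including the loss caused by users departing
later. -/
def workNeeded {N : ℕ} (α : ℝ) (d a : Fin N → ℝ) (i : Fin N) : ℝ :=
  1 + α * ∑ j ∈ Ioi i, max 0 (d i - a j)

theorem continuous_workAfter {N : ℕ} (α β : ℝ) (d : Fin N → ℝ) (i : Fin N) :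
    Continuous (workAfter α β d i) := by
  unfold workAfter
  fun_prop

theorem workAfter_self {N : ℕ} (α β : ℝ) {d : Fin N → ℝ} (hd : Monotone d) (i : Fin N) :
    workAfter α β d i (d i) = 0 := by
  have hsum : ∑ j ∈ Iio i, max 0 (d j - d i) = 0 :=
    Finset.sum_eq_zero fun j hj => max_eq_left (sub_nonpos.2 (hd (Finset.mem_Iio.1 hj).le))
  simp [workAfter, hsum]

theorem le_workAfter_sub {N : ℕ} {α : ℝ} (β : ℝ) (hα : 0 < α) (d : Fin N → ℝ) (i : Fin N)
    {x y : ℝ} (hxy : x ≤ y) :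
    (β - α * ((N : ℝ) - 1)) * (y - x) ≤ workAfter α β d i x - workAfter α β d i y := by
  have hsum : ∑ j ∈ Iio i, max 0 (d j - x) - ∑ j ∈ Iio i, max 0 (d j - y)
      ≤ ((N : ℝ) - 1) * (y - x) := by
    rw [← Finset.sum_sub_distrib]
    calc _ ≤ ∑ _j ∈ Iio i, (y - x) := Finset.sum_le_sum fun j _ => by grind
      _ = (i : ℝ) * (y - x) := by rw [Finset.sum_const, Fin.card_Iio, nsmul_eq_mul]
      _ ≤ _ := by
        have hi : ((i : ℕ) : ℝ) + 1 ≤ N := by exact_mod_cast i.isLt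
        gcongr
        linarith
  unfold workAfter
  nlinarith [mul_le_mul_of_nonneg_left hsum hα.le]

theorem strictAnti_workAfter {N : ℕ} {α β : ℝ} (hα : 0 < α)
    (hstab : 0 < β - α * ((N : ℝ) - 1)) (d : Fin N → ℝ) (i : Fin N) :
    StrictAnti (workAfter α β d i) := fun x y hxy => by
  have := le_workAfter_sub β hα d i hxy.le
  have := mul_pos hstab (sub_pos.2 hxy)
  linarith

theorem exists_workAfter_eq {N : ℕ} {α β : ℝ} (hα : 0 < α)
    (hstab : 0 < β - α * ((N : ℝ) - 1)) {d : Fin N → ℝ} (hd : Monotone d) (i : Fin N)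
    {c : ℝ} (hc : 0 ≤ c) : ∃ x, workAfter α β d i x = c := by
  set κ := β - α * ((N : ℝ) - 1)
  have hx : d i - c / κ ≤ d i := sub_le_self _ (div_nonneg hc hstab.le)
  have hle := le_workAfter_sub β hα d i hx
  rw [workAfter_self α β hd, sub_zero, sub_sub_cancel, mul_div_cancel₀ _ hstab.ne'] at hle
  obtain ⟨x, -, h⟩ := intermediate_value_Icc' hx (continuous_workAfter α β d i).continuousOn
    ⟨(workAfter_self α β hd i).trans_le hc, hle⟩
  exact ⟨x, h⟩

theorem one_le_workNeeded {N : ℕ} {α : ℝ} (hα : 0 < α) (d a : Fin N → ℝ) (i : Fin N) :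
    1 ≤ workNeeded α d a i :=
  le_add_of_nonneg_right <| mul_nonneg hα.le <| Finset.sum_nonneg fun _ _ => le_max_left _ _

/-- For ordered arrivals and departures, the dynamics become a triangular system. -/
theorem integral_serviceRate_eq_one_iff {N : ℕ} {α β : ℝ} {a d : Fin N → ℝ} (ha : Monotone a)
    (hd : Monotone d) (i : Fin N) (hi : a i < d i) :
    ∫ t in a i..d i, serviceRate α β a d t = 1 ↔
      workAfter α β d i (a i) = workNeeded α d a i := by
  have hsplit : ∑ j, max 0 (min (d i) (d j) - max (a i) (a j))
      = ∑ j ∈ Iio i, max 0 (d j - a i) + ((d i - a i) + ∑ j ∈ Ioi i, max 0 (d i - a j)) := by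
    have huniv : (Finset.univ : Finset (Fin N)) = Iio i ∪ insert i (Ioi i) := by
      ext j; grind
    have hdisj : Disjoint (Iio i) (insert i (Ioi i)) := by
      rw [Finset.disjoint_left]; grind
    rw [huniv, Finset.sum_union hdisj, Finset.sum_insert (by simp)]
    congr 1
    · refine Finset.sum_congr rfl fun j hj => ?_
      have hj := (Finset.mem_Iio.1 hj).le
      rw [min_eq_right (hd hj), max_eq_left (ha hj)]
    · congr 1
      · rw [min_self, max_self, max_eq_right (sub_pos.2 hi).le]
      · refine Finset.sum_congr rfl fun j hj => ?_
        have hj := (Finset.mem_Ioi.1 hj).le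
        rw [min_eq_left (hd hj), max_eq_right (ha hj)]
  rw [integral_serviceRate α β a d hi.le, hsplit, workAfter, workNeeded]
  constructor <;> intro h <;> linarith

/-- Solutions of the triangular system are ordered. -/
theorem monotone_of_workAfter_eq {N : ℕ} {α β : ℝ} (hα : 0 < α)
    (hstab : 0 < β - α * ((N : ℝ) - 1)) {a d : Fin N → ℝ} (hd : Monotone d)
    (h : ∀ i, workAfter α β d i (a i) = workNeeded α d a i) : Monotone a := by
  rw [monotone_iff_forall_covBy]
  intro i k hik
  rw [← (strictAnti_workAfter hα hstab d i).le_iff_ge, h i]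
  have hlt := hik.lt
  have hgap (j : Fin N) : i < j → ¬ j < k := fun hj => hik.2 hj
  have hIio : Iio k = insert i (Iio i) := by
    ext j; simp only [Finset.mem_Iio, Finset.mem_insert]; grind
  have hIoi : Ioi i = insert k (Ioi k) := by
    ext j; simp only [Finset.mem_Ioi, Finset.mem_insert]; grind
  have hk := h k
  have hdik : 0 ≤ d k - d i := sub_nonneg.2 (hd hik.le)
  have hsum : ∑ j ∈ Ioi k, max 0 (d k - a j) - ∑ j ∈ Ioi k, max 0 (d i - a j)
      ≤ ((N : ℝ) - 1) * (d k - d i) := by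
    rw [← Finset.sum_sub_distrib]
    calc _ ≤ ∑ _j ∈ Ioi k, (d k - d i) := Finset.sum_le_sum fun j _ => by grind
      _ = (#(Ioi k) : ℝ) * (d k - d i) := by rw [Finset.sum_const, nsmul_eq_mul]
      _ ≤ _ := by
        have hcard : (#(Ioi k) : ℝ) + 1 ≤ N := by
          have := k.isLt
          rw [Fin.card_Ioi]
          exact_mod_cast (by omega : N - 1 - (k : ℕ) + 1 ≤ N)
        gcongr
        linarith
  unfold workAfter workNeeded at *
  rw [hIio, Finset.sum_insert (by simp)] at hk
  rw [hIoi, Finset.sum_insert (by simp)]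
  nlinarith [mul_le_mul_of_nonneg_left hsum hα.le, mul_nonneg hstab.le hdik]

theorem exists_workAfter_eq_workNeeded {N : ℕ} {α β : ℝ} (hα : 0 < α)
    (hstab : 0 < β - α * ((N : ℝ) - 1)) {d : Fin N → ℝ} (hd : Monotone d) :
    ∃ a : Fin N → ℝ, ∀ i, workAfter α β d i (a i) = workNeeded α d a i := by
  choose g hg using fun (i : Fin N) (c : ℝ) (hc : 0 ≤ c) => exists_workAfter_eq hα hstab hd i hc
  have hneed := fun a i => zero_le_one.trans (one_le_workNeeded hα d a i)
  let step (i : Fin N) (later : ∀ j, j > i → ℝ) : ℝ :=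
    let a : Fin N → ℝ := fun j => if hj : j > i then later j hj else 0
    g i (workNeeded α d a i) (hneed a i)
  let a : Fin N → ℝ := IsWellFounded.fix (· > ·) step
  refine ⟨a, fun i => ?_⟩
  have hfix : a i = step i fun j _ => a j := IsWellFounded.fix_eq (· > ·) step i
  rw [hfix, hg]
  unfold workNeeded
  congr 2
  refine Finset.sum_congr rfl fun j hj => ?_
  beta_reduce
  rw [dif_pos (Finset.mem_Ioi.1 hj)]

theorem eq_of_workAfter_eq_workNeeded {N : ℕ} {α β : ℝ} (hα : 0 < α)
    (hstab : 0 < β - α * ((N : ℝ) - 1)) {d a b : Fin N → ℝ}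
    (ha : ∀ i, workAfter α β d i (a i) = workNeeded α d a i)
    (hb : ∀ i, workAfter α β d i (b i) = workNeeded α d b i) : a = b := by
  funext i
  induction i using WellFoundedGT.induction with
  | ind i ih =>
    apply (strictAnti_workAfter hα hstab d i).injective
    rw [ha, hb]
    unfold workNeeded
    congr 2
    exact Finset.sum_congr rfl fun j hj => by rw [ih j (Finset.mem_Ioi.1 hj)]

/-- For every nondecreasing departure vector there is exactly one arrival vector
satisfying the dynamics. -/
theorem existsUnique_arrivals
    (N : ℕ) (hN : 1 ≤ N) (α β : ℝ) (hα : 0 < α) (hβ : 0 < β)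
    (hstab : 0 < β - α * ((N : ℝ) - 1))
    (d : Fin N → ℝ) (hd : Monotone d) :
    ∃! a : Fin N → ℝ, SlowdownDynamics N α β a d := by
  obtain ⟨a, ha⟩ := exists_workAfter_eq_workNeeded hα hstab hd
  have hmono := monotone_of_workAfter_eq hα hstab hd ha
  have hlt (i : Fin N) : a i < d i := by
    rw [← (strictAnti_workAfter hα hstab d i).lt_iff_gt, workAfter_self α β hd, ha]
    exact zero_lt_one.trans_le (one_le_workNeeded hα d a i)
  refine ⟨a, ⟨hlt, fun i => (integral_serviceRate_eq_one_iff hmono hd i (hlt i)).2 (ha i)⟩,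
    fun b hb => eq_of_workAfter_eq_workNeeded hα hstab (fun i => ?_) ha⟩
  exact (integral_serviceRate_eq_one_iff (hb.monotone hα hstab hd) hd i (hb.1 i)).1 (hb.2 i)
end

section
/- Suppose a and d are both nondecreasing and satisfy the dynamics, and let k_i and h_i be defined as stated. Then d_1 = (1 + β a_1 − α ∑_{j=2}^{k_1} a_j)/(β − α(k_1 − 1)) and a_N = (β d_N − α ∑_{j=h_N}^{N−1} d_j − 1)/(β − α(N − h_N)). -/
open MeasureTheory Finset

lemma intervalIntegrable_ite_mem_Icc (u v x y : ℝ) :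
    IntervalIntegrable (fun t => if t ∈ Set.Icc x y then (1 : ℝ) else 0) volume u v := by
  refine (intervalIntegrable_const (c := (1 : ℝ))).mono_fun ?_ ?_
  · exact (Measurable.ite measurableSet_Icc measurable_const
      measurable_const).aestronglyMeasurable
  · filter_upwards with t
    split_ifs <;> simp

/-- The time spent in `[x, y]` during the interval from `u` to `v`. -/
lemma integral_ite_mem_Icc {u v : ℝ} (huv : u ≤ v) (x y : ℝ) :
    ∫ t in u..v, (if t ∈ Set.Icc x y then (1 : ℝ) else 0) =
      max (min v y - max u x) 0 := by
  have hind : (fun t => if t ∈ Set.Icc x y then (1 : ℝ) else 0) =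
      (Set.Icc x y).indicator (fun _ => 1) := by
    ext t
    simp [Set.indicator_apply]
  rw [hind, intervalIntegral.integral_of_le huv, ← integral_Icc_eq_integral_Ioc,
    setIntegral_indicator measurableSet_Icc, Set.Icc_inter_Icc, setIntegral_const,
    Real.volume_real_Icc]
  simp

lemma SlowdownDynamics.work_eq_one {N : ℕ} {α β : ℝ} {a d : Fin N → ℝ}
    (hdyn : SlowdownDynamics N α β a d) (i : Fin N) :
    β * (d i - a i) -
      α * ((∑ j, max (min (d i) (d j) - max (a i) (a j)) 0) - (d i - a i)) = 1 := by
  have hsum : IntervalIntegrable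
      (fun t => ∑ j : Fin N, if t ∈ Set.Icc (a j) (d j) then (1 : ℝ) else 0)
      volume (a i) (d i) := by
    simpa only [Finset.sum_fn] using IntervalIntegrable.sum Finset.univ
      fun j _ => intervalIntegrable_ite_mem_Icc (a i) (d i) (a j) (d j)
  have hwork := hdyn.2 i
  rw [intervalIntegral.integral_sub intervalIntegrable_const
      ((hsum.sub intervalIntegrable_const).const_mul α),
    intervalIntegral.integral_const_mul,
    intervalIntegral.integral_sub hsum intervalIntegrable_const,
    intervalIntegral.integral_finsetSum
      fun j _ => intervalIntegrable_ite_mem_Icc (a i) (d i) (a j) (d j)] at hwork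
  simp only [integral_ite_mem_Icc (hdyn.1 i).le, intervalIntegral.integral_const,
    smul_eq_mul] at hwork
  linarith

lemma SlowdownDynamics.sum_overlap_first {N : ℕ} {α β : ℝ} {a d : Fin N → ℝ}
    (hdyn : SlowdownDynamics N α β a d) (ha : Monotone a) (hd : Monotone d)
    {i k : Fin N} (hi : ∀ j, i ≤ j) (hak : a k ≤ d i)
    (hk : ∀ m, a m ≤ d i → m ≤ k) :
    ∑ j, max (min (d i) (d j) - max (a i) (a j)) 0 =
      (d i - a i) + ∑ j ∈ Finset.Ioc i k, (d i - a j) := by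
  have hover (j : Fin N) : min (d i) (d j) - max (a i) (a j) = d i - a j := by
    rw [min_eq_left (hd (hi j)), max_eq_right (ha (hi j))]
  simp only [hover]
  rw [← Finset.sum_subset (Finset.subset_univ (Finset.Icc i k)),
    ← Finset.Ioc_insert_left (hi k), Finset.sum_insert (by simp),
    max_eq_left (sub_nonneg.2 (hdyn.1 i).le)]
  · congr 1
    refine Finset.sum_congr rfl fun j hj => max_eq_left (sub_nonneg.2 ?_)
    exact (ha (Finset.mem_Ioc.1 hj).2).trans hak
  · intro j _ hj
    refine max_eq_right (sub_nonpos.2 (le_of_not_ge fun hle => hj ?_))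
    exact Finset.mem_Icc.2 ⟨hi j, hk j hle⟩

lemma SlowdownDynamics.sum_overlap_last {N : ℕ} {α β : ℝ} {a d : Fin N → ℝ}
    (hdyn : SlowdownDynamics N α β a d) (ha : Monotone a) (hd : Monotone d)
    {i h : Fin N} (hi : ∀ j, j ≤ i) (hdh : a i ≤ d h)
    (hh : ∀ m, a i ≤ d m → h ≤ m) :
    ∑ j, max (min (d i) (d j) - max (a i) (a j)) 0 =
      (d i - a i) + ∑ j ∈ Finset.Ico h i, (d j - a i) := by
  have hover (j : Fin N) : min (d i) (d j) - max (a i) (a j) = d j - a i := by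
    rw [min_eq_right (hd (hi j)), max_eq_left (ha (hi j))]
  simp only [hover]
  rw [← Finset.sum_subset (Finset.subset_univ (Finset.Icc h i)),
    ← Finset.Ico_insert_right (hi h), Finset.sum_insert (by simp),
    max_eq_left (sub_nonneg.2 (hdyn.1 i).le)]
  · congr 1
    refine Finset.sum_congr rfl fun j hj => max_eq_left (sub_nonneg.2 ?_)
    exact hdh.trans (hd (Finset.mem_Ico.1 hj).1)
  · intro j _ hj
    refine max_eq_right (sub_nonpos.2 (le_of_not_ge fun hle => hj ?_))
    exact Finset.mem_Icc.2 ⟨hh j hle, hi j⟩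

/-- Closed-form expressions for the first departure time and the last arrival
time in terms of the index sequences `k` and `h`. -/
theorem first_departure_last_arrival_formulas
    (N : ℕ) (hN : 0 < N) (α β : ℝ) (hα : 0 < α) (hβ : 0 < β)
    (hstab : 0 < β - α * ((N : ℝ) - 1))
    (a d : Fin N → ℝ) (ha : Monotone a) (hd : Monotone d)
    (hdyn : SlowdownDynamics N α β a d)
    (k h : Fin N → Fin N)
    (hk : ∀ i : Fin N, a (k i) ≤ d i ∧ ∀ m : Fin N, a m ≤ d i → m ≤ k i)
    (hh : ∀ i : Fin N, a i ≤ d (h i) ∧ ∀ m : Fin N, a i ≤ d m → h i ≤ m) :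
    d ⟨0, hN⟩ =
      (1 + β * a ⟨0, hN⟩ -
          α * ∑ j ∈ Finset.Ioc (⟨0, hN⟩ : Fin N) (k ⟨0, hN⟩), a j) /
        (β - α * ((k ⟨0, hN⟩ : ℕ) : ℝ)) ∧
    a ⟨N - 1, Nat.sub_lt hN Nat.one_pos⟩ =
      (β * d ⟨N - 1, Nat.sub_lt hN Nat.one_pos⟩ -
          α * ∑ j ∈ Finset.Ico (h ⟨N - 1, Nat.sub_lt hN Nat.one_pos⟩)
            (⟨N - 1, Nat.sub_lt hN Nat.one_pos⟩ : Fin N), d j - 1) /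
        (β - α * ((((N : ℝ) - 1)) -
          ((h ⟨N - 1, Nat.sub_lt hN Nat.one_pos⟩ : ℕ) : ℝ))) := by
  constructor
  · have hwork := hdyn.work_eq_one ⟨0, hN⟩
    rw [hdyn.sum_overlap_first ha hd (fun j => Fin.mk_le_of_le_val (Nat.zero_le j))
      (hk _).1 (hk _).2, Finset.sum_sub_distrib, Finset.sum_const, Fin.card_Ioc,
      nsmul_eq_mul, Nat.sub_zero] at hwork
    have hkN : ((k ⟨0, hN⟩ : ℕ) : ℝ) ≤ (N : ℝ) - 1 := by
      rw [le_sub_iff_add_le]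
      exact_mod_cast (k ⟨0, hN⟩).isLt
    rw [eq_div_iff (by nlinarith)]
    linarith
  · have hle (j : Fin N) : j ≤ ⟨N - 1, Nat.sub_lt hN Nat.one_pos⟩ :=
      Fin.le_def.2 (Nat.le_sub_one_of_lt j.isLt)
    have hwork := hdyn.work_eq_one ⟨N - 1, Nat.sub_lt hN Nat.one_pos⟩
    rw [hdyn.sum_overlap_last ha hd hle (hh _).1 (hh _).2, Finset.sum_sub_distrib,
      Finset.sum_const, Fin.card_Ico, nsmul_eq_mul, Nat.cast_sub (Fin.le_def.1 (hle _)),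
      Nat.cast_sub (Nat.one_le_of_lt hN), Nat.cast_one] at hwork
    have hh0 : (0 : ℝ) ≤ ((h ⟨N - 1, Nat.sub_lt hN Nat.one_pos⟩ : ℕ) : ℝ) :=
      Nat.cast_nonneg _
    rw [eq_div_iff (by nlinarith)]
    linarith
end
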